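/- Let B be a finite left brace of cardinality m·n with gcd(m,n) = 1, let B1 and B2 be the (unique) additive subgroups of (B,+) of orders m and n respectively, and assume B1 and B2 are closed under ∘ and that B1 is a normal subgroup of the multiplicative group (B,∘). Then for every b ∈ B2: (i) λ_b maps B1 into B1; (ii) for every a ∈ B1, the multiplicative conjugate b∘a∘b⁻¹ equals λ_b(a), and b ∘ a = λ_b(a) + b; (iii) the restriction of λ_b to B1 is a bijection of B1 preserving both + and ∘ (a brace automorphism of B1). -/

import Mathlib

/-- A left brace structure on an additive commutative group `B`: a second group
operation `circ` (with inverse `inv` and identity `0`) satisfying the left brace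
compatibility law `a ∘ (b + c) + a = a ∘ b + a ∘ c`. -/
structure BraceMul (B : Type*) [AddCommGroup B] where
  circ : B → B → B
  inv : B → B
  circ_assoc : ∀ a b c, circ (circ a b) c = circ a (circ b c)
  zero_circ : ∀ a, circ 0 a = a
  circ_zero : ∀ a, circ a 0 = a
  inv_circ : ∀ a, circ (inv a) a = 0
  circ_inv : ∀ a, circ a (inv a) = 0
  compat : ∀ a b c, circ a (b + c) + a = circ a b + circ a c

/-- The lambda map of a left brace: `λ_a(b) = -a + a ∘ b`. -/
def BraceMul.lam {B : Type*} [AddCommGroup B] (br : BraceMul B) (a b : B) : B :=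
  -a + br.circ a b

/-- A subgroup whose order is coprime to its index contains every element killed by its order. -/
theorem AddSubgroup.mem_of_card_nsmul_eq_zero {A : Type*} [AddCommGroup A] {H : AddSubgroup A}
    (hH : (Nat.card H).Coprime H.index) {x : A} (hx : Nat.card H • x = 0) : x ∈ H := by
  have hbez : (1 : ℤ) = Nat.card H * (Nat.card H).gcdA H.index +
      H.index * (Nat.card H).gcdB H.index := by
    rw [← Nat.gcd_eq_gcd_ab, hH.gcd_eq_one, Nat.cast_one]
  rw [← one_zsmul x, hbez, add_zsmul, mul_comm, mul_zsmul, natCast_zsmul, hx, zsmul_zero,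
    zero_add, mul_comm, mul_zsmul, natCast_zsmul]
  exact H.zsmul_mem (H.nsmul_index_mem x) _

/-- A subgroup whose order is coprime to its index is fully invariant. -/
theorem AddSubgroup.map_mem_of_coprime_card_index {A : Type*} [AddCommGroup A]
    {H : AddSubgroup A} (hH : (Nat.card H).Coprime H.index) (f : A →+ A) {x : A} (hx : x ∈ H) :
    f x ∈ H := by
  refine mem_of_card_nsmul_eq_zero hH ?_
  have hzero : Nat.card H • x = 0 :=
    congrArg Subtype.val (card_nsmul_eq_zero' (x := (⟨x, hx⟩ : H)))
  rw [← map_nsmul, hzero, map_zero]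

namespace BraceMul

variable {B : Type*} [AddCommGroup B] (br : BraceMul B)

theorem circ_eq_add_lam (a b : B) : br.circ a b = a + br.lam a b := by
  simp [lam]

theorem lam_add (a b c : B) : br.lam a (b + c) = br.lam a b + br.lam a c := by
  simp only [lam]
  rw [eq_sub_of_add_eq (br.compat a b c)]
  abel

theorem lam_injective (a : B) : Function.Injective (br.lam a) := by
  intro x y hxy
  have hcirc : br.circ a x = br.circ a y := add_left_cancel hxy
  rw [← br.zero_circ x, ← br.inv_circ a, br.circ_assoc, hcirc, ← br.circ_assoc, br.inv_circ,
    br.zero_circ]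

/-- The map `lam a` as an endomorphism of the additive group. -/
def lamHom (a : B) : B →+ B :=
  AddMonoidHom.mk' (br.lam a) (br.lam_add a)

theorem conj_circ (g a b : B) :
    br.circ (br.circ g (br.circ a b)) (br.inv g) =
      br.circ (br.circ (br.circ g a) (br.inv g)) (br.circ (br.circ g b) (br.inv g)) := by
  simp only [br.circ_assoc]
  rw [← br.circ_assoc (br.inv g) g, br.inv_circ, br.zero_circ]

end BraceMul

theorem statement3 (m n : ℕ) (hmn : Nat.Coprime m n)
    (B : Type) [AddCommGroup B] [Finite B] (br : BraceMul B)
    (hcard : Nat.card B = m * n)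
    (B1 B2 : AddSubgroup B) (hB1 : Nat.card B1 = m) (hB2 : Nat.card B2 = n)
    (hB1circ : ∀ a ∈ B1, ∀ b ∈ B1, br.circ a b ∈ B1)
    (hB2circ : ∀ a ∈ B2, ∀ b ∈ B2, br.circ a b ∈ B2)
    (hB1norm : ∀ g : B, ∀ a ∈ B1, br.circ (br.circ g a) (br.inv g) ∈ B1) :
    ∀ b ∈ B2,
      (∀ a ∈ B1, br.lam b a ∈ B1) ∧
      (∀ a ∈ B1, br.circ (br.circ b a) (br.inv b) = br.lam b a ∧
        br.circ b a = br.lam b a + b) ∧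
      Set.BijOn (br.lam b) (B1 : Set B) (B1 : Set B) ∧
      (∀ a ∈ B1, ∀ a' ∈ B1, br.lam b (a + a') = br.lam b a + br.lam b a') ∧
      (∀ a ∈ B1, ∀ a' ∈ B1, br.lam b (br.circ a a') = br.circ (br.lam b a) (br.lam b a')) := by
  have hpos : 0 < m * n := hcard ▸ Nat.card_pos
  have hidx1 : B1.index = n := by
    have h := B1.card_mul_index
    rw [hB1, hcard] at h
    exact Nat.eq_of_mul_eq_mul_left (Nat.pos_of_mul_pos_right hpos) h
  have hidx2 : B2.index = m := by
    have h := B2.card_mul_index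
    rw [hB2, hcard, mul_comm m n] at h
    exact Nat.eq_of_mul_eq_mul_left (Nat.pos_of_mul_pos_left hpos) h
  have hcop1 : (Nat.card B1).Coprime B1.index := by rwa [hB1, hidx1]
  have hcop2 : (Nat.card B2).Coprime B2.index := by rw [hB2, hidx2]; exact hmn.symm
  have hdisj : Disjoint B1 B2 :=
    AddSubgroup.disjoint_of_coprime_natCard (by rwa [hB1, hB2])
  intro b hb
  have hmem : ∀ a ∈ B1, br.lam b a ∈ B1 := fun a ha =>
    AddSubgroup.map_mem_of_coprime_card_index hcop1 (br.lamHom b) ha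
  have hconj : ∀ a ∈ B1, br.circ (br.circ b a) (br.inv b) = br.lam b a := by
    intro a ha
    set c := br.circ (br.circ b a) (br.inv b) with hc
    have hlam : br.lam c b ∈ B2 :=
      AddSubgroup.map_mem_of_coprime_card_index hcop2 (br.lamHom c) hb
    have heq : c + br.lam c b = b + br.lam b a := by
      rw [← br.circ_eq_add_lam, ← br.circ_eq_add_lam, hc, br.circ_assoc, br.inv_circ,
        br.circ_zero]
    have hdiff : c - br.lam b a = b - br.lam c b := by
      rw [sub_eq_sub_iff_add_eq_add, heq]
    refine sub_eq_zero.1 (AddSubgroup.disjoint_def.1 hdisj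
      (B1.sub_mem (hB1norm b a ha) (hmem a ha)) ?_)
    rw [hdiff]
    exact B2.sub_mem hb hlam
  refine ⟨hmem, fun a ha => ⟨hconj a ha, ?_⟩, ?_, fun a _ a' _ => br.lam_add b a a', ?_⟩
  · rw [br.circ_eq_add_lam, add_comm]
  · exact ((Set.toFinite _).injOn_iff_bijOn_of_mapsTo hmem).1 (br.lam_injective b).injOn
  · intro a ha a' ha'
    rw [← hconj _ (hB1circ a ha a' ha'), ← hconj a ha, ← hconj a' ha', br.conj_circ]
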